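/- arXiv:1505.01930 — 2 statements merged into one kernel-verified Lean document; each statement's English description precedes it below -/
import Mathlib

section
/- Let p, T > 0 and let u : ℝ² → ℝ be continuous on [0,p]×[−T,0], with u_x, u_xx, u_t existing and continuous on Ω⁻ = (0,p)×(−T,0), satisfying u_t = −u_xx on Ω⁻, u(0,t) = u(p,t) = 0 for t ∈ (−T,0), and for each t ∈ (−T,0), lim_{x→0⁺} x·u_x(x,t) = 0 and lim_{x→p⁻} (p−x)·u_x(x,t) = 0. For n ≥ 1 define β_n(t) = ∫₀^p u(x,t)·X_n(x) dx. Then for each n ≥ 1, β_n is differentiable on (−T,0) and satisfies the ordinary differential equation β_n'(t) − λ_n²·β_n(t) = 0 for all t ∈ (−T,0). -/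
open Set Filter Topology intervalIntegral

/-- `λ_n = nπ/p`. -/
noncomputable def lam (p : ℝ) (n : ℕ) : ℝ := n * Real.pi / p

/-- `X_n(x) = √(2/p)·sin(λ_n x)`. -/
noncomputable def Xf (p : ℝ) (n : ℕ) (x : ℝ) : ℝ :=
  Real.sqrt (2 / p) * Real.sin (lam p n * x)

/-- The limit at `0` of a jointly continuous family of functions with jointly continuous
derivatives is differentiable, with the limiting derivative. -/
theorem hasDerivAt_zero_of_continuous_of_pos {B G : ℝ → ℝ → ℝ} {S : Set ℝ} (hS : IsOpen S)
    (hB : Continuous B.uncurry) (hG : Continuous G.uncurry)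
    (h : ∀ s > 0, ∀ t ∈ S, HasDerivAt (B s) (G s t) t) {t : ℝ} (ht : t ∈ S) :
    HasDerivAt (B 0) (G 0 t) t := by
  let g : C(ℝ, C(ℝ, ℝ)) := ContinuousMap.curry ⟨G.uncurry, hG⟩
  have hg : Tendsto g (𝓝[>] 0) (𝓝 (g 0)) := (g.continuous.tendsto 0).mono_left nhdsWithin_le_nhds
  refine hasDerivAt_of_tendstoLocallyUniformlyOn (l := 𝓝[>] (0 : ℝ)) (f := B) hS
    (ContinuousMap.tendsto_iff_tendstoLocallyUniformly.1 hg).tendstoLocallyUniformlyOn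
    (eventually_nhdsWithin_of_forall h) (fun τ _ => ?_) ht
  have hτ : Continuous fun s => B s τ := hB.comp (by fun_prop : Continuous fun s : ℝ => (s, τ))
  exact (hτ.tendsto 0).mono_left nhdsWithin_le_nhds

/-- Differentiation under the integral sign on a compact interval. -/
theorem hasDerivAt_intervalIntegral_of_continuousOn {a b : ℝ} (hab : a ≤ b) {S : Set ℝ}
    (hS : IsOpen S) {f f' : ℝ → ℝ → ℝ} (hf : ContinuousOn f.uncurry (Icc a b ×ˢ S))
    (hf' : ContinuousOn f'.uncurry (Icc a b ×ˢ S))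
    (hd : ∀ x ∈ Icc a b, ∀ t ∈ S, HasDerivAt (f x) (f' x t) t) {t : ℝ} (ht : t ∈ S) :
    HasDerivAt (fun τ => ∫ x in a..b, f x τ) (∫ x in a..b, f' x t) t := by
  obtain ⟨δ, hδ, hball⟩ := Metric.nhds_basis_closedBall.mem_iff.1 (hS.mem_nhds ht)
  obtain ⟨C, hC⟩ := (isCompact_Icc.prod (isCompact_closedBall t δ)).exists_bound_of_continuousOn
    (hf'.mono (prod_mono_right hball))
  have hslice : ∀ {k : ℝ → ℝ → ℝ}, ContinuousOn k.uncurry (Icc a b ×ˢ S) → ∀ τ ∈ S,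
      IntervalIntegrable (fun x => k x τ) MeasureTheory.volume a b := fun hk τ hτ =>
    ContinuousOn.intervalIntegrable_of_Icc hab <|
      hk.comp (f := fun x => (x, τ)) (by fun_prop) fun x hx => ⟨hx, hτ⟩
  have hsub : uIoc a b ⊆ Icc a b := by
    rw [uIoc_of_le hab]
    exact Ioc_subset_Icc_self
  refine (intervalIntegral.hasDerivAt_integral_of_dominated_loc_of_deriv_le (F := fun τ x => f x τ)
    (F' := fun τ x => f' x τ) (bound := fun _ => C) (Metric.closedBall_mem_nhds t hδ) ?_
    (hslice hf t ht) (hslice hf' t ht).def'.aestronglyMeasurable ?_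
    intervalIntegrable_const ?_).2
  · filter_upwards [hS.mem_nhds ht] with τ hτ
    exact (hslice hf τ hτ).def'.aestronglyMeasurable
  · exact .of_forall fun x hx τ hτ => hC (x, τ) ⟨hsub hx, hτ⟩
  · exact .of_forall fun x hx τ hτ => hd x (hsub hx) τ (hball hτ)

/-- Integration of `v''` against a sine vanishing at both ends of the interval. -/
theorem integral_deriv_deriv_mul_sin {a b μ : ℝ} (hab : a ≤ b) {n : ℕ}
    (hμ : μ * (b - a) = n * Real.pi) {v v' v'' : ℝ → ℝ}
    (hv : ∀ x ∈ Icc a b, HasDerivAt v (v' x) x)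
    (hv' : ∀ x ∈ Icc a b, HasDerivAt v' (v'' x) x) (hv'' : ContinuousOn v'' (Icc a b)) :
    ∫ x in a..b, v'' x * Real.sin (μ * (x - a)) =
      μ * (v a - v b * Real.cos (n * Real.pi)) -
        μ ^ 2 * ∫ x in a..b, v x * Real.sin (μ * (x - a)) := by
  have hvc : ContinuousOn v (Icc a b) := fun x hx => (hv x hx).continuousAt.continuousWithinAt
  have hi : ∀ {w : ℝ → ℝ}, ContinuousOn w (Icc a b) → IntervalIntegrable
      (fun x => w x * Real.sin (μ * (x - a))) MeasureTheory.volume a b := fun hw =>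
    (hw.mul (by fun_prop)).intervalIntegrable_of_Icc hab
  have key := integral_eq_sub_of_hasDerivAt
    (f := fun x => v' x * Real.sin (μ * (x - a)) - v x * (μ * Real.cos (μ * (x - a))))
    (f' := fun x => v'' x * Real.sin (μ * (x - a)) + μ ^ 2 * (v x * Real.sin (μ * (x - a))))
    (a := a) (b := b) (fun x hx => by
      rw [uIcc_of_le hab] at hx
      have hl : HasDerivAt (fun x => μ * (x - a)) μ x := by
        simpa using ((hasDerivAt_id x).sub_const a).const_mul μ
      refine (((hv' x hx).mul hl.sin).sub ((hv x hx).mul (hl.cos.const_mul μ))).congr_deriv ?_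
      ring) ((hi hv'').add ((hi hvc).const_mul _))
  rw [integral_add (hi hv'') ((hi hvc).const_mul _), integral_const_mul] at key
  simp only [hμ, sub_self, mul_zero, Real.sin_zero, Real.cos_zero, Real.sin_nat_mul_pi] at key
  linarith

/-- The sine coefficients, relative to an interior interval, of a solution of the backward heat
equation. -/
theorem hasDerivAt_integral_mul_sin_of_heat {a b μ : ℝ} (hab : a ≤ b) {n : ℕ}
    (hμ : μ * (b - a) = n * Real.pi) {S : Set ℝ} (hS : IsOpen S) {u ux uxx : ℝ → ℝ → ℝ}
    (hu : ContinuousOn u.uncurry (Icc a b ×ˢ S)) (huxx : ContinuousOn uxx.uncurry (Icc a b ×ˢ S))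
    (hdx : ∀ x ∈ Icc a b, ∀ t ∈ S, HasDerivAt (fun y => u y t) (ux x t) x)
    (hdxx : ∀ x ∈ Icc a b, ∀ t ∈ S, HasDerivAt (fun y => ux y t) (uxx x t) x)
    (hdt : ∀ x ∈ Icc a b, ∀ t ∈ S, HasDerivAt (u x) (-uxx x t) t) {t : ℝ} (ht : t ∈ S) :
    HasDerivAt (fun τ => ∫ x in a..b, u x τ * Real.sin (μ * (x - a)))
      (μ * (u b t * Real.cos (n * Real.pi) - u a t) +
        μ ^ 2 * ∫ x in a..b, u x t * Real.sin (μ * (x - a))) t := by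
  have hsin : ContinuousOn (fun q : ℝ × ℝ => Real.sin (μ * (q.1 - a))) (Icc a b ×ˢ S) := by
    fun_prop
  have h := hasDerivAt_intervalIntegral_of_continuousOn hab hS
    (f := fun x τ => u x τ * Real.sin (μ * (x - a)))
    (f' := fun x τ => -uxx x τ * Real.sin (μ * (x - a)))
    (hu.mul hsin) (huxx.neg.mul hsin) (fun x hx τ hτ => (hdt x hx τ hτ).mul_const _) ht
  have hibp := integral_deriv_deriv_mul_sin hab hμ (fun x hx => hdx x hx t ht)
    (fun x hx => hdxx x hx t ht)
    (huxx.comp (f := fun x => (x, t)) (by fun_prop) fun x hx => ⟨hx, ht⟩ :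
      ContinuousOn (fun x => uxx x t) (Icc a b))
  simp only [neg_mul, integral_neg] at h
  convert h using 1
  linarith

/-- A function continuous on a closed rectangle agrees there with a continuous function. -/
theorem exists_continuous_eqOn_rectangle {a b c d : ℝ} (hab : a ≤ b) (hcd : c ≤ d)
    {u : ℝ → ℝ → ℝ} (hu : ContinuousOn u.uncurry (Icc a b ×ˢ Icc c d)) :
    ∃ U : ℝ → ℝ → ℝ, Continuous U.uncurry ∧ ∀ x ∈ Icc a b, ∀ t ∈ Icc c d, U x t = u x t := by
  refine ⟨fun x t => u (projIcc a b hab x) (projIcc c d hcd t), ?_, fun x hx t ht => ?_⟩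
  · exact hu.comp_continuous
      (f := fun q : ℝ × ℝ => ((projIcc a b hab q.1 : ℝ), (projIcc c d hcd q.2 : ℝ)))
      (by fun_prop) fun q => ⟨Subtype.coe_prop _, Subtype.coe_prop _⟩
  · simp only [projIcc_of_mem hab hx, projIcc_of_mem hcd ht]

/-- The Fourier coefficients `β_n(t) = ∫₀^p u(x,t) X_n(x) dx` of a solution of the
backward heat equation `u_t = -u_xx` on `Ω⁻ = (0,p)×(-T,0)` satisfy
`β_n' - λ_n² β_n = 0`. -/
theorem stmt3 (p T : ℝ) (hp : 0 < p) (hT : 0 < T) (u : ℝ → ℝ → ℝ)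
    -- continuity of `u` on the closed rectangle `[0,p] × [-T,0]`
    (hu_cont : ContinuousOn (fun q : ℝ × ℝ => u q.1 q.2) (Icc 0 p ×ˢ Icc (-T) 0))
    -- existence of the partial derivatives u_x, u_xx, u_t on Ω⁻
    (hdiff : ∀ q : ℝ × ℝ, q ∈ Ioo 0 p ×ˢ Ioo (-T) (0:ℝ) →
      DifferentiableAt ℝ (fun y => u y q.2) q.1 ∧
      DifferentiableAt ℝ (deriv (fun y => u y q.2)) q.1 ∧
      DifferentiableAt ℝ (fun s => u q.1 s) q.2)
    -- continuity of the partial derivatives on Ω⁻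
    (hux_cont : ContinuousOn (fun q : ℝ × ℝ => deriv (fun y => u y q.2) q.1)
      (Ioo 0 p ×ˢ Ioo (-T) (0:ℝ)))
    (huxx_cont : ContinuousOn (fun q : ℝ × ℝ => deriv (deriv (fun y => u y q.2)) q.1)
      (Ioo 0 p ×ˢ Ioo (-T) (0:ℝ)))
    (hut_cont : ContinuousOn (fun q : ℝ × ℝ => deriv (fun s => u q.1 s) q.2)
      (Ioo 0 p ×ˢ Ioo (-T) (0:ℝ)))
    -- the backward heat equation `u_t = -u_xx` on Ω⁻
    (hheat : ∀ x ∈ Ioo (0:ℝ) p, ∀ t ∈ Ioo (-T) (0:ℝ),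
      deriv (fun s => u x s) t = - deriv (deriv (fun y => u y t)) x)
    -- boundary conditions
    (hbc : ∀ t ∈ Ioo (-T) (0:ℝ), u 0 t = 0 ∧ u p t = 0)
    -- regularity conditions at the lateral boundary
    (hreg : ∀ t ∈ Ioo (-T) (0:ℝ),
      Tendsto (fun x => x * deriv (fun y => u y t) x) (𝓝[>] 0) (𝓝 0) ∧
      Tendsto (fun x => (p - x) * deriv (fun y => u y t) x) (𝓝[<] p) (𝓝 0)) :
    ∀ n : ℕ, 1 ≤ n → ∀ t ∈ Ioo (-T) (0:ℝ),
      DifferentiableAt ℝ (fun s => ∫ x in (0:ℝ)..p, u x s * Xf p n x) t ∧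
      deriv (fun s => ∫ x in (0:ℝ)..p, u x s * Xf p n x) t
        - (lam p n) ^ 2 * (∫ x in (0:ℝ)..p, u x t * Xf p n x) = 0 := by
  intro n _ t ht
  obtain ⟨U, hU, hUu⟩ := exists_continuous_eqOn_rectangle hp.le (by linarith : -T ≤ 0) hu_cont
  -- The coefficient on the interval of length `L s` centred at `p / 2`, rescaled to `[0, 1]`.
  let L : ℝ → ℝ := fun s => p * Real.exp (-s)
  let a : ℝ → ℝ := fun s => (p - L s) / 2
  let B : ℝ → ℝ → ℝ := fun s τ =>
    L s * ∫ y in (0:ℝ)..1, U (a s + L s * y) τ * Real.sin (n * Real.pi * y)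
  let G : ℝ → ℝ → ℝ := fun s τ =>
    n * Real.pi / L s * (U (a s + L s) τ * Real.cos (n * Real.pi) - U (a s) τ) +
      (n * Real.pi / L s) ^ 2 * B s τ
  have hL0 : ∀ s, 0 < L s := fun s => by positivity
  have hLc : Continuous L := by fun_prop
  have hac : Continuous a := by fun_prop
  have hUc : ∀ {X : Type} [TopologicalSpace X] {f g : X → ℝ}, Continuous f → Continuous g →
      Continuous fun x => U (f x) (g x) := fun hf hg => hU.comp (hf.prodMk hg)
  have hB : Continuous B.uncurry := by
    refine (hLc.comp continuous_fst).mul ?_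
    refine continuous_parametric_intervalIntegral_of_continuous' ?_ 0 1
    exact (hUc (by fun_prop) (by fun_prop)).mul (by fun_prop)
  have hμc : Continuous fun q : ℝ × ℝ => n * Real.pi / L q.1 :=
    continuous_const.div (by fun_prop) fun q => (hL0 q.1).ne'
  have hG : Continuous G.uncurry :=
    (hμc.mul (((hUc (by fun_prop) (by fun_prop)).mul continuous_const).sub
      (hUc (by fun_prop) (by fun_prop)))).add ((hμc.pow 2).mul hB)
  have hBu : ∀ s ≥ 0, ∀ τ ∈ Ioo (-T) 0, B s τ = ∫ x in (a s)..(a s + L s),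
      u x τ * Real.sin (n * Real.pi / L s * (x - a s)) := by
    intro s hs τ hτ
    have hLs : L s ≤ p := mul_le_of_le_one_right hp.le (Real.exp_le_one_iff.2 (by linarith))
    have hsub := smul_integral_comp_add_mul (a := 0) (b := 1)
      (fun x => U x τ * Real.sin (n * Real.pi / L s * (x - a s))) (L s) (a s)
    simp only [mul_zero, add_zero, mul_one, smul_eq_mul] at hsub
    have harg : ∀ y, n * Real.pi / L s * (a s + L s * y - a s) = n * Real.pi * y := fun y => by
      field_simp [(hL0 s).ne']
      ring
    simp only [harg] at hsub
    refine hsub.trans (integral_congr fun x hx => ?_)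
    rw [uIcc_of_le (by linarith [hL0 s])] at hx
    have hx' : x ∈ Icc 0 p := by
      simp only [a] at hx
      exact ⟨by linarith [hx.1], by linarith [hx.2]⟩
    simp only [hUu x hx' τ (Ioo_subset_Icc_self hτ)]
  have hd : ∀ s > 0, ∀ τ ∈ Ioo (-T) 0, HasDerivAt (B s) (G s τ) τ := by
    intro s hs τ hτ
    have hLs : L s < p := mul_lt_of_lt_one_right hp (Real.exp_lt_one_iff.2 (by linarith))
    have hI : Icc (a s) (a s + L s) ⊆ Ioo 0 p := fun x hx => by
      simp only [a] at hx
      exact ⟨by linarith [hx.1], by linarith [hx.2]⟩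
    have hle : a s ≤ a s + L s := by linarith [hL0 s]
    have h := hasDerivAt_integral_mul_sin_of_heat hle (n := n) (μ := n * Real.pi / L s)
      (by rw [add_sub_cancel_left, div_mul_cancel₀ _ (hL0 s).ne']) isOpen_Ioo
      (ux := fun x t => deriv (fun y => u y t) x)
      (uxx := fun x t => deriv (deriv (fun y => u y t)) x)
      (hu_cont.mono (prod_mono (hI.trans Ioo_subset_Icc_self) Ioo_subset_Icc_self))
      (huxx_cont.mono (prod_mono_left hI))
      (fun x hx τ hτ => (hdiff (x, τ) ⟨hI hx, hτ⟩).1.hasDerivAt)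
      (fun x hx τ hτ => (hdiff (x, τ) ⟨hI hx, hτ⟩).2.1.hasDerivAt)
      (fun x hx τ hτ => by
        rw [← hheat x (hI hx) τ hτ]
        exact (hdiff (x, τ) ⟨hI hx, hτ⟩).2.2.hasDerivAt) hτ
    have hmem : ∀ x ∈ Icc (a s) (a s + L s), U x τ = u x τ := fun x hx =>
      hUu x (Ioo_subset_Icc_self (hI hx)) τ (Ioo_subset_Icc_self hτ)
    rw [← hmem _ (left_mem_Icc.2 hle), ← hmem _ (right_mem_Icc.2 hle), ← hBu s hs.le τ hτ] at h
    refine h.congr_of_eventuallyEq ?_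
    filter_upwards [isOpen_Ioo.mem_nhds hτ] with r hr using hBu s hs.le r hr
  have hlim := hasDerivAt_zero_of_continuous_of_pos isOpen_Ioo hB hG hd ht
  have hL : L 0 = p := by simp [L]
  have ha : a 0 = 0 := by simp [a, hL]
  have hG0 : G 0 t = lam p n ^ 2 * B 0 t := by
    have h0 := hUu 0 ⟨le_rfl, hp.le⟩ t (Ioo_subset_Icc_self ht)
    have h1 := hUu p ⟨hp.le, le_rfl⟩ t (Ioo_subset_Icc_self ht)
    rw [(hbc t ht).1] at h0
    rw [(hbc t ht).2] at h1
    simp [G, hL, ha, h0, h1, lam]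
  have hβ : ∀ τ ∈ Ioo (-T) 0,
      ∫ x in (0:ℝ)..p, u x τ * Xf p n x = Real.sqrt (2 / p) * B 0 τ := by
    intro τ hτ
    rw [hBu 0 le_rfl τ hτ, ← integral_const_mul]
    simp only [ha, hL, zero_add, sub_zero, Xf, lam, mul_left_comm]
  have hfin : HasDerivAt (fun s => ∫ x in (0:ℝ)..p, u x s * Xf p n x)
      (Real.sqrt (2 / p) * G 0 t) t := by
    refine (hlim.const_mul _).congr_of_eventuallyEq ?_
    filter_upwards [isOpen_Ioo.mem_nhds ht] with τ hτ using hβ τ hτ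
  refine ⟨hfin.differentiableAt, ?_⟩
  rw [hfin.deriv, hβ t ht, hG0]
  ring
end

section
/- Let p, T > 0 and let f : [0,p]×[−T,T] → ℝ be continuous, with partial derivative ∂f/∂x existing and continuous on [0,p]×[−T,T], f(0,t) = f(p,t) = 0 for all t ∈ [−T,T], and suppose there exist C > 0 and α ∈ (0,1) such that |∂f/∂x(x,t) − ∂f/∂x(y,t)| ≤ C·|x−y|^α for all x, y ∈ [0,p] and all t ∈ [−T,T]. Then the series Σ_{n=1}^∞ f_n(t)·X_n(x) converges absolutely and uniformly on [0,p]×[−T,T]. -/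
open Set Filter Topology intervalIntegral

/-- Fourier coefficient `f_n(t) = ∫₀^p f(x,t) X_n(x) dx`. -/
noncomputable def fcoef (p : ℝ) (f : ℝ → ℝ → ℝ) (n : ℕ) (t : ℝ) : ℝ :=
  ∫ x in (0:ℝ)..p, f x t * Xf p n x

theorem lam_pos {p : ℝ} (hp : 0 < p) {n : ℕ} (hn : 0 < n) : 0 < lam p n := by
  have : (0 : ℝ) < n := by exact_mod_cast hn
  unfold lam
  positivity

/-- The integral of `cos (λ_n x)` over a half wave between consecutive multiples of `p / n`
vanishes. -/
theorem integral_cos_lam_half_wave {p : ℝ} (hp : 0 < p) {n : ℕ} (hn : 0 < n) (k : ℕ) :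
    ∫ x in (k * (p / n) : ℝ)..((k + 1 : ℕ) * (p / n) : ℝ), Real.cos (lam p n * x) = 0 := by
  have hn' : (n : ℝ) ≠ 0 := by exact_mod_cast hn.ne'
  have hnode (j : ℕ) : lam p n * (j * (p / n)) = j * Real.pi := by
    unfold lam
    field_simp
  rw [intervalIntegral.integral_comp_mul_left (fun y => Real.cos y) (lam_pos hp hn).ne',
    integral_cos, hnode, hnode, Real.sin_nat_mul_pi, Real.sin_nat_mul_pi]
  simp

/-- Cosine coefficients of a Hölder continuous function of exponent `α` decay like `n ^ (-α)`. -/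
theorem abs_integral_mul_cos_lam_le {p C α : ℝ} (hp : 0 < p) (hC : 0 ≤ C) (hα : 0 ≤ α)
    {g : ℝ → ℝ} (hg : ContinuousOn g (Icc 0 p))
    (hH : ∀ x ∈ Icc (0 : ℝ) p, ∀ y ∈ Icc (0 : ℝ) p, |g x - g y| ≤ C * |x - y| ^ α)
    {n : ℕ} (hn : 0 < n) :
    |∫ x in (0 : ℝ)..p, g x * Real.cos (lam p n * x)| ≤ C * p * (p / n) ^ α := by
  have hn' : (0 : ℝ) < n := by exact_mod_cast hn
  set h : ℝ := p / n with hh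
  have hh0 : 0 < h := by positivity
  have hnh : n * h = p := by rw [hh]; field_simp
  have hcos : Continuous fun x => Real.cos (lam p n * x) := by fun_prop
  have hle (k : ℕ) : (k * h : ℝ) ≤ (k + 1 : ℕ) * h := by
    gcongr
    simp
  have hsub (k : ℕ) (hk : k < n) : Icc (k * h : ℝ) ((k + 1 : ℕ) * h) ⊆ Icc 0 p := by
    apply Icc_subset_Icc (by positivity)
    rw [← hnh]
    gcongr
    exact hk
  have hint (k : ℕ) (hk : k < n) : IntervalIntegrable (fun x => g x * Real.cos (lam p n * x))
      MeasureTheory.volume (k * h : ℝ) ((k + 1 : ℕ) * h) := by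
    apply ContinuousOn.intervalIntegrable
    rw [uIcc_of_le (hle k)]
    exact (hg.mono (hsub k hk)).mul hcos.continuousOn
  have hsum := intervalIntegral.sum_integral_adjacent_intervals
    (a := fun k : ℕ => (k * h : ℝ)) (n := n) hint
  simp only [Nat.cast_zero, zero_mul, hnh] at hsum
  have hterm (k : ℕ) (hk : k < n) :
      |∫ x in (k * h : ℝ)..((k + 1 : ℕ) * h : ℝ), g x * Real.cos (lam p n * x)|
        ≤ C * h ^ α * h := by
    have hcentre : ∫ x in (k * h : ℝ)..((k + 1 : ℕ) * h : ℝ), g x * Real.cos (lam p n * x) =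
        ∫ x in (k * h : ℝ)..((k + 1 : ℕ) * h : ℝ),
          (g x - g (k * h)) * Real.cos (lam p n * x) := by
      simp only [sub_mul]
      rw [intervalIntegral.integral_sub (hint k hk)
        ((hcos.const_mul _).intervalIntegrable _ _), intervalIntegral.integral_const_mul,
        integral_cos_lam_half_wave hp hn, mul_zero, sub_zero]
    rw [hcentre]
    have hbound := intervalIntegral.norm_integral_le_of_norm_le_const
      (a := (k * h : ℝ)) (b := ((k + 1 : ℕ) * h : ℝ)) (C := C * h ^ α)
      (f := fun x => (g x - g (k * h)) * Real.cos (lam p n * x)) (fun x hx => by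
        rw [uIoc_of_le (hle k)] at hx
        have hxk : |x - k * h| ≤ h := by
          have := hx.2
          push_cast at this
          rw [abs_of_nonneg (by linarith [hx.1])]
          linarith
        rw [Real.norm_eq_abs, abs_mul]
        calc |g x - g (k * h)| * |Real.cos (lam p n * x)| ≤ |g x - g (k * h)| * 1 := by
              gcongr
              exact Real.abs_cos_le_one _
          _ ≤ C * |x - k * h| ^ α := by
              rw [mul_one]
              exact hH x (hsub k hk (Ioc_subset_Icc_self hx)) _
                (hsub k hk (left_mem_Icc.2 (hle k)))
          _ ≤ C * h ^ α := by gcongr)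
    have hlen : |((k + 1 : ℕ) * h : ℝ) - k * h| = h := by
      push_cast
      rw [add_mul, one_mul, add_sub_cancel_left, abs_of_pos hh0]
    rwa [hlen, Real.norm_eq_abs] at hbound
  rw [← hsum]
  calc _ ≤ ∑ k ∈ Finset.range n,
        |∫ x in (k * h : ℝ)..((k + 1 : ℕ) * h : ℝ), g x * Real.cos (lam p n * x)| :=
        Finset.abs_sum_le_sum_abs _ _
    _ ≤ ∑ _k ∈ Finset.range n, C * h ^ α * h :=
        Finset.sum_le_sum fun k hk => hterm k (Finset.mem_range.1 hk)
    _ = C * p * h ^ α := by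
        rw [Finset.sum_const, Finset.card_range, nsmul_eq_mul, ← hnh]
        ring

/-- Integration by parts turns sine coefficients into cosine coefficients of the derivative. -/
theorem integral_mul_sin_lam {p : ℝ} (hp : 0 < p) {u u' : ℝ → ℝ}
    (hu : ∀ x ∈ Icc (0 : ℝ) p, HasDerivAt u (u' x) x) (hu' : ContinuousOn u' (Icc 0 p))
    (h0 : u 0 = 0) (h1 : u p = 0) {n : ℕ} (hn : 0 < n) :
    ∫ x in (0 : ℝ)..p, u x * Real.sin (lam p n * x) =
      (lam p n)⁻¹ * ∫ x in (0 : ℝ)..p, u' x * Real.cos (lam p n * x) := by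
  have hl := (lam_pos hp hn).ne'
  have hv (x : ℝ) : HasDerivAt (fun y => -((lam p n)⁻¹ * Real.cos (lam p n * y)))
      (Real.sin (lam p n * x)) x := by
    refine ((((hasDerivAt_id' x).const_mul (lam p n)).cos).const_mul (lam p n)⁻¹).neg.congr_deriv ?_
    field_simp
  rw [intervalIntegral.integral_mul_deriv_eq_deriv_mul
    (fun x hx => hu x (by rwa [uIcc_of_le hp.le] at hx)) (fun x _ => hv x)
    (by
      apply ContinuousOn.intervalIntegrable
      rwa [uIcc_of_le hp.le])
    (Continuous.intervalIntegrable (by fun_prop) _ _), h0, h1, zero_mul, zero_mul, sub_zero,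
    zero_sub, ← intervalIntegral.integral_neg, ← intervalIntegral.integral_const_mul]
  congr 1
  ext x
  ring

theorem abs_Xf_le (p : ℝ) (n : ℕ) (x : ℝ) : |Xf p n x| ≤ √(2 / p) := by
  rw [Xf, abs_mul, abs_of_nonneg (Real.sqrt_nonneg _)]
  exact mul_le_of_le_one_right (Real.sqrt_nonneg _) (Real.abs_sin_le_one _)

/-- Sine coefficients of a function vanishing at the endpoints whose derivative is Hölder
continuous of exponent `α` decay like `n ^ (-(1 + α))`. -/
theorem abs_fcoef_le {p C α t : ℝ} (hp : 0 < p) (hC : 0 ≤ C) (hα : 0 ≤ α)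
    {f : ℝ → ℝ → ℝ} {u' : ℝ → ℝ}
    (hf : ∀ x ∈ Icc (0 : ℝ) p, HasDerivAt (fun y => f y t) (u' x) x)
    (hu' : ContinuousOn u' (Icc 0 p)) (h0 : f 0 t = 0) (h1 : f p t = 0)
    (hH : ∀ x ∈ Icc (0 : ℝ) p, ∀ y ∈ Icc (0 : ℝ) p, |u' x - u' y| ≤ C * |x - y| ^ α)
    {n : ℕ} (hn : 0 < n) :
    |fcoef p f n t| ≤ √(2 / p) * (p / Real.pi) * (C * p * p ^ α) * ((n : ℝ) ^ (1 + α))⁻¹ := by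
  have hn' : (0 : ℝ) < n := by exact_mod_cast hn
  have hl := lam_pos hp hn
  have hcoef : fcoef p f n t = √(2 / p) * ∫ x in (0 : ℝ)..p, f x t * Real.sin (lam p n * x) := by
    simp only [fcoef, Xf]
    rw [← intervalIntegral.integral_const_mul]
    congr 1
    ext x
    ring
  rw [hcoef, integral_mul_sin_lam hp hf hu' h0 h1 hn, abs_mul, abs_mul,
    abs_of_nonneg (Real.sqrt_nonneg _), abs_of_pos (inv_pos.2 hl)]
  calc _ ≤ √(2 / p) * ((lam p n)⁻¹ * (C * p * (p / n) ^ α)) := by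
        gcongr
        exact abs_integral_mul_cos_lam_le hp hC hα hu' hH hn
    _ = _ := by
        rw [Real.div_rpow hp.le hn'.le, Real.rpow_add hn', Real.rpow_one, lam]
        field_simp

/-- Lemma 1: under the stated hypotheses on `f`, the series `Σ f_n(t) X_n(x)`
converges absolutely and uniformly on `[0,p] × [-T,T]`. -/
theorem stmt5 (p T : ℝ) (hp : 0 < p) (hT : 0 < T) (f : ℝ → ℝ → ℝ)
    -- `f` is continuous on the closed rectangle
    (hf_cont : ContinuousOn (fun q : ℝ × ℝ => f q.1 q.2) (Icc 0 p ×ˢ Icc (-T) T))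
    -- `∂f/∂x` exists and is continuous on the closed rectangle
    (hfx_diff : ∀ q : ℝ × ℝ, q ∈ Icc (0:ℝ) p ×ˢ Icc (-T) T →
      DifferentiableAt ℝ (fun y => f y q.2) q.1)
    (hfx_cont : ContinuousOn (fun q : ℝ × ℝ => deriv (fun y => f y q.2) q.1)
      (Icc 0 p ×ˢ Icc (-T) T))
    -- `f(0,t) = f(p,t) = 0`
    (hbc : ∀ t ∈ Icc (-T) T, f 0 t = 0 ∧ f p t = 0)
    -- `∂f/∂x ∈ Lip_α[0,p]` uniformly in `t`
    (hLip : ∃ C > (0:ℝ), ∃ α ∈ Ioo (0:ℝ) 1, ∀ x ∈ Icc (0:ℝ) p, ∀ y ∈ Icc (0:ℝ) p,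
      ∀ t ∈ Icc (-T) T,
      |deriv (fun z => f z t) x - deriv (fun z => f z t) y| ≤ C * |x - y| ^ α) :
    -- absolute convergence at every point of the rectangle
    (∀ q ∈ Icc (0:ℝ) p ×ˢ Icc (-T) T,
      Summable (fun n : ℕ => |fcoef p f (n + 1) q.2 * Xf p (n + 1) q.1|)) ∧
    -- uniform convergence of the partial sums on the rectangle
    TendstoUniformlyOn
      (fun N (q : ℝ × ℝ) => ∑ n ∈ Finset.range N, fcoef p f (n + 1) q.2 * Xf p (n + 1) q.1)
      (fun q => ∑' n : ℕ, fcoef p f (n + 1) q.2 * Xf p (n + 1) q.1)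
      atTop (Icc (0:ℝ) p ×ˢ Icc (-T) T) := by
  obtain ⟨C, hC, α, hα, hH⟩ := hLip
  have hslice (t : ℝ) (ht : t ∈ Icc (-T) T) :
      ContinuousOn (fun x => deriv (fun y => f y t) x) (Icc 0 p) :=
    hfx_cont.comp (f := fun x : ℝ => (x, t)) (by fun_prop) fun x hx => ⟨hx, ht⟩
  set M : ℝ := √(2 / p) * (p / Real.pi) * (C * p * p ^ α) * √(2 / p)
  have hbound (n : ℕ) (q : ℝ × ℝ) (hq : q ∈ Icc (0 : ℝ) p ×ˢ Icc (-T) T) :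
      ‖fcoef p f (n + 1) q.2 * Xf p (n + 1) q.1‖ ≤ M * (((n + 1 : ℕ) : ℝ) ^ (1 + α))⁻¹ := by
    rw [norm_mul, Real.norm_eq_abs, Real.norm_eq_abs]
    refine (mul_le_mul
      (abs_fcoef_le hp hC.le hα.1.le (fun x hx => (hfx_diff (x, q.2) ⟨hx, hq.2⟩).hasDerivAt)
        (hslice q.2 hq.2) (hbc q.2 hq.2).1 (hbc q.2 hq.2).2
        (fun x hx y hy => hH x hx y hy q.2 hq.2) n.succ_pos)
      (abs_Xf_le p (n + 1) q.1) (abs_nonneg _) (by positivity)).trans_eq (by ring)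
  have hsum : Summable fun n : ℕ => M * (((n + 1 : ℕ) : ℝ) ^ (1 + α))⁻¹ :=
    ((summable_nat_add_iff 1).2 (Real.summable_nat_rpow_inv.2 (by linarith [hα.1]))).mul_left M
  exact ⟨fun q hq => hsum.of_nonneg_of_le (fun _ => abs_nonneg _) fun n => hbound n q hq,
    tendstoUniformlyOn_tsum_nat hsum hbound⟩
end
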